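/- arXiv:math/0202126 — 3 statements merged into one kernel-verified Lean document; each statement's English description precedes it below -/
import Mathlib

section
/- Let D be a differential operator on ℝ^n which is homogeneous of degree −r for some integer r ≥ 1, i.e. E(Df) − D(Ef) = −r·Df for all f ∈ C^∞(ℝ^n). Then ∫_{ℝ^n} (Df)(ξ) d^nξ = 0 for every compactly supported f ∈ C_c^∞(ℝ^n). -/
open MeasureTheory

noncomputable section

/-- Real-valued functions on `ℝ^n`. -/
abbrev Fn (n : ℕ) := (Fin n → ℝ) → ℝ

/-- Partial derivative `∂f/∂ξ_i`. -/
def pd {n : ℕ} (i : Fin n) (f : Fn n) : Fn n :=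
  fun ξ => fderiv ℝ f ξ (Pi.single i 1)

/-- Iterated partial derivative `∂^α f` for a multi-index `α : Fin n → ℕ`. -/
def mderiv {n : ℕ} (α : Fin n → ℕ) (f : Fn n) : Fn n :=
  (List.finRange n).foldr (fun i acc => (pd i)^[α i] acc) f

/-- The Euler vector field applied to a function: `(Ef)(ξ) = Σ_i ξ_i ∂f/∂ξ_i`. -/
def eulerOp {n : ℕ} (f : Fn n) : Fn n := fun ξ => ∑ i, ξ i * pd i f ξ

/-- A differential operator on `ℝ^n`: `Df = Σ_{α} a_α ∂^α f` with finitely many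
multi-indices `α` and smooth coefficients `a_α`. -/
structure DiffOp (n : ℕ) where
  supp : Finset (Fin n → ℕ)
  coeff : (Fin n → ℕ) → Fn n
  coeff_smooth : ∀ α, ContDiff ℝ (⊤ : ℕ∞) (coeff α)

/-- Application of a differential operator to a function. -/
def DiffOp.app {n : ℕ} (D : DiffOp n) (f : Fn n) : Fn n :=
  fun ξ => ∑ α ∈ D.supp, D.coeff α ξ * mderiv α f ξ

/-- Smooth functions with compact support. -/
def IsTestFn {n : ℕ} (f : Fn n) : Prop := ContDiff ℝ (⊤ : ℕ∞) f ∧ HasCompactSupport f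

/-- `A` preserves test functions and has a formal transpose preserving smooth functions. -/
def HasSmoothTranspose {n : ℕ} (A : Fn n → Fn n) : Prop :=
  (∀ f, IsTestFn f → IsTestFn (A f)) ∧
    ∀ g : Fn n, ContDiff ℝ (⊤ : ℕ∞) g → ∃ h : Fn n, ContDiff ℝ (⊤ : ℕ∞) h ∧
      ∀ f, IsTestFn f → ∫ ξ, g ξ * A f ξ = ∫ ξ, h ξ * f ξ

theorem ContDiff.pd {n : ℕ} {f : Fn n} (hf : ContDiff ℝ (⊤ : ℕ∞) f) (i : Fin n) :
    ContDiff ℝ (⊤ : ℕ∞) (pd i f) :=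
  (hf.fderiv_right (by simp)).clm_apply contDiff_const

theorem IsTestFn.pd {n : ℕ} {f : Fn n} (hf : IsTestFn f) (i : Fin n) : IsTestFn (pd i f) :=
  ⟨hf.1.pd i, hf.2.fderiv_apply (𝕜 := ℝ) _⟩

theorem IsTestFn.mul_left {n : ℕ} {f g : Fn n} (hf : IsTestFn f)
    (hg : ContDiff ℝ (⊤ : ℕ∞) g) : IsTestFn (fun ξ => g ξ * f ξ) :=
  ⟨hg.mul hf.1, hf.2.mul_left⟩

theorem IsTestFn.sum {n : ℕ} {ι : Type*} {s : Finset ι} {F : ι → Fn n}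
    (hF : ∀ i ∈ s, IsTestFn (F i)) : IsTestFn (fun ξ => ∑ i ∈ s, F i ξ) := by
  classical
  induction s using Finset.induction_on with
  | empty => exact ⟨contDiff_const, HasCompactSupport.zero⟩
  | insert a s ha ih =>
    have h1 := hF a (Finset.mem_insert_self a s)
    have h2 := ih fun i hi => hF i (Finset.mem_insert_of_mem hi)
    simp only [Finset.sum_insert ha]
    exact ⟨h1.1.add h2.1, h1.2.add h2.2⟩

theorem IsTestFn.integrable {n : ℕ} {f : Fn n} (hf : IsTestFn f) : Integrable f :=
  hf.1.continuous.integrable_of_hasCompactSupport hf.2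

theorem integral_mul_pd {n : ℕ} {f g : Fn n} (hg : ContDiff ℝ (⊤ : ℕ∞) g)
    (hf : IsTestFn f) (i : Fin n) :
    ∫ ξ, g ξ * pd i f ξ = -∫ ξ, pd i g ξ * f ξ :=
  integral_mul_fderiv_eq_neg_fderiv_mul_of_integrable
    (hf.mul_left (hg.pd i)).integrable ((hf.pd i).mul_left hg).integrable
    (hf.mul_left hg).integrable (fun x _ => hg.differentiable (by simp) x)
    (fun x _ => hf.1.differentiable (by simp) x)

theorem hasSmoothTranspose_pd {n : ℕ} (i : Fin n) : HasSmoothTranspose (pd i) :=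
  ⟨fun _ hf => hf.pd i, fun g hg => ⟨fun ξ => -pd i g ξ, (hg.pd i).neg, fun f hf => by
    simp [integral_mul_pd hg hf, integral_neg]⟩⟩

theorem hasSmoothTranspose_id {n : ℕ} : HasSmoothTranspose (fun f : Fn n => f) :=
  ⟨fun _ hf => hf, fun g hg => ⟨g, hg, fun _ _ => rfl⟩⟩

theorem HasSmoothTranspose.comp {n : ℕ} {A B : Fn n → Fn n} (hA : HasSmoothTranspose A)
    (hB : HasSmoothTranspose B) : HasSmoothTranspose (fun f => A (B f)) := by
  refine ⟨fun f hf => hA.1 _ (hB.1 f hf), fun g hg => ?_⟩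
  obtain ⟨h, hh, hAh⟩ := hA.2 g hg
  obtain ⟨k, hk, hBk⟩ := hB.2 h hh
  exact ⟨k, hk, fun f hf => (hAh _ (hB.1 f hf)).trans (hBk f hf)⟩

theorem HasSmoothTranspose.iterate {n : ℕ} {A : Fn n → Fn n} (hA : HasSmoothTranspose A)
    (k : ℕ) : HasSmoothTranspose (A^[k]) := by
  induction k with
  | zero => exact hasSmoothTranspose_id
  | succ k ih => exact ih.comp hA

theorem hasSmoothTranspose_mderiv {n : ℕ} (α : Fin n → ℕ) : HasSmoothTranspose (mderiv α) := by
  unfold mderiv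
  induction List.finRange n with
  | nil => exact hasSmoothTranspose_id
  | cons i l ih => exact ((hasSmoothTranspose_pd i).iterate (α i)).comp ih

theorem DiffOp.hasSmoothTranspose {n : ℕ} (D : DiffOp n) : HasSmoothTranspose D.app := by
  have htest : ∀ f, IsTestFn f → ∀ α, IsTestFn fun ξ => D.coeff α ξ * mderiv α f ξ :=
    fun f hf α => ((hasSmoothTranspose_mderiv α).1 f hf).mul_left (D.coeff_smooth α)
  refine ⟨fun f hf => IsTestFn.sum fun α _ => htest f hf α, fun g hg => ?_⟩
  choose h hh hint using fun α =>
    (hasSmoothTranspose_mderiv α).2 (fun ξ => g ξ * D.coeff α ξ) (hg.mul (D.coeff_smooth α))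
  refine ⟨fun ξ => ∑ α ∈ D.supp, h α ξ, ContDiff.sum fun α _ => hh α, fun f hf => ?_⟩
  simp only [DiffOp.app, Finset.mul_sum, Finset.sum_mul]
  rw [integral_finsetSum _ fun α _ => ((htest f hf α).mul_left hg).integrable,
    integral_finsetSum _ fun α _ => (hf.mul_left (hh α)).integrable]
  refine Finset.sum_congr rfl fun α _ => ?_
  simpa only [mul_assoc] using hint α f hf

theorem contDiff_coord {n : ℕ} (i : Fin n) : ContDiff ℝ (⊤ : ℕ∞) (fun ξ : Fin n → ℝ => ξ i) :=
  contDiff_apply ℝ ℝ i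

theorem ContDiff.eulerOp {n : ℕ} {f : Fn n} (hf : ContDiff ℝ (⊤ : ℕ∞) f) :
    ContDiff ℝ (⊤ : ℕ∞) (eulerOp f) :=
  ContDiff.sum fun i _ => (contDiff_coord i).mul (hf.pd i)

theorem IsTestFn.eulerOp {n : ℕ} {f : Fn n} (hf : IsTestFn f) : IsTestFn (eulerOp f) :=
  IsTestFn.sum fun i _ => (hf.pd i).mul_left (contDiff_coord i)

theorem pd_mul_coord {n : ℕ} {g : Fn n} (hg : ContDiff ℝ (⊤ : ℕ∞) g) (i : Fin n)
    (ξ : Fin n → ℝ) : pd i (fun η => g η * η i) ξ = g ξ + ξ i * pd i g ξ := by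
  have h := ((hg.differentiable (by simp) ξ).hasFDerivAt).mul
    (hasFDerivAt_apply (𝕜 := ℝ) i ξ)
  change fderiv ℝ (g * fun η => η i) ξ (Pi.single i 1) = _
  rw [h.fderiv]
  simp [pd]

theorem integral_mul_eulerOp {n : ℕ} {f g : Fn n} (hg : ContDiff ℝ (⊤ : ℕ∞) g)
    (hf : IsTestFn f) :
    ∫ ξ, g ξ * eulerOp f ξ = -∫ ξ, (n * g ξ + eulerOp g ξ) * f ξ := by
  have hgi : ∀ i, ContDiff ℝ (⊤ : ℕ∞) fun ξ : Fin n → ℝ => g ξ * ξ i :=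
    fun i => hg.mul (contDiff_coord i)
  calc ∫ ξ, g ξ * eulerOp f ξ
      = ∫ ξ, ∑ i, (g ξ * ξ i) * pd i f ξ := by
        simp only [_root_.eulerOp, Finset.mul_sum, mul_assoc]
    _ = ∑ i, -∫ ξ, pd i (fun η => g η * η i) ξ * f ξ := by
        rw [integral_finsetSum _ fun i _ => ((hf.pd i).mul_left (hgi i)).integrable]
        exact Finset.sum_congr rfl fun i _ => integral_mul_pd (hgi i) hf i
    _ = -∫ ξ, ∑ i, pd i (fun η => g η * η i) ξ * f ξ := by
        rw [integral_finsetSum _ fun i _ => (hf.mul_left ((hgi i).pd i)).integrable,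
          Finset.sum_neg_distrib]
    _ = -∫ ξ, (n * g ξ + eulerOp g ξ) * f ξ := by
        simp only [pd_mul_coord hg, ← Finset.sum_mul, Finset.sum_add_distrib]
        simp [_root_.eulerOp]

theorem fderiv_apply_eq_sum_pd {n : ℕ} (h : Fn n) (x ξ : Fin n → ℝ) :
    fderiv ℝ h x ξ = ∑ i, ξ i * pd i h x := by
  conv_lhs => rw [pi_eq_sum_univ' ξ]
  simp [pd]

/-- A smooth function that is homogeneous of negative degree vanishes. -/
theorem eq_zero_of_eulerOp_eq {n : ℕ} {h : Fn n} (hh : ContDiff ℝ (⊤ : ℕ∞) h) {r : ℕ}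
    (hr : 1 ≤ r) (hE : ∀ ξ, eulerOp h ξ + r * h ξ = 0) (ξ : Fin n → ℝ) : h ξ = 0 := by
  obtain ⟨k, rfl⟩ := Nat.exists_eq_add_of_le' hr
  have hderiv : ∀ t : ℝ, HasDerivAt (fun t : ℝ => t ^ (k + 1) * h (t • ξ)) 0 t := by
    intro t
    have hline : HasDerivAt (fun t : ℝ => t • ξ) ξ t := by
      simpa using (hasDerivAt_id t).smul_const ξ
    have hcomp := (hh.differentiable (by simp) (t • ξ)).hasFDerivAt.comp_hasDerivAt t hline
    have hprod := (hasDerivAt_pow (k + 1) t).mul hcomp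
    refine hprod.congr_deriv ?_
    have hEt := hE (t • ξ)
    have hsum : eulerOp h (t • ξ) = t * fderiv ℝ h (t • ξ) ξ := by
      rw [fderiv_apply_eq_sum_pd, Finset.mul_sum]
      simp [_root_.eulerOp, mul_assoc]
    rw [hsum] at hEt
    simp only [Function.comp, Nat.add_sub_cancel]
    linear_combination t ^ k * hEt
  have hconst := is_const_of_deriv_eq_zero (fun t => (hderiv t).differentiableAt)
    (fun t => (hderiv t).deriv) 1 0
  simpa using hconst

theorem eq_zero_of_forall_integral_mul_eq_zero {n : ℕ} {h : Fn n} (hh : Continuous h)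
    (hint : ∀ f, IsTestFn f → ∫ ξ, h ξ * f ξ = 0) (ξ : Fin n → ℝ) : h ξ = 0 := by
  have hae : ∀ᵐ x, h x = 0 :=
    ae_eq_zero_of_integral_contDiff_smul_eq_zero hh.locallyIntegrable fun g hg hgc => by
      simpa only [smul_eq_mul, mul_comm] using hint g ⟨hg, hgc⟩
  exact congrFun ((hh.ae_eq_iff_eq volume continuous_const).1 hae) ξ

/-- If `D` is a differential operator on `ℝ^n` which is homogeneous of degree `−r`
with `r ≥ 1`, i.e. `E(Df) − D(Ef) = −r·Df` for all smooth `f`, then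
`∫ Df d^nξ = 0` for every compactly supported smooth `f`. -/
theorem statement1 {n : ℕ} (D : DiffOp n) (r : ℕ) (hr : 1 ≤ r)
    (hhom : ∀ f : Fn n, ContDiff ℝ (⊤ : ℕ∞) f →
      ∀ ξ, eulerOp (D.app f) ξ - D.app (eulerOp f) ξ = -(r : ℝ) * D.app f ξ) :
    ∀ f : Fn n, ContDiff ℝ (⊤ : ℕ∞) f → HasCompactSupport f →
      ∫ ξ, D.app f ξ = 0 := by
  intro f hfs hfc
  have hf : IsTestFn f := ⟨hfs, hfc⟩
  obtain ⟨h, hh, hint⟩ := D.hasSmoothTranspose.2 (fun _ => 1) contDiff_const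
  simp only [one_mul] at hint
  have hEh : ∀ ξ, eulerOp h ξ + r * h ξ = 0 := by
    refine eq_zero_of_forall_integral_mul_eq_zero
      (hh.eulerOp.continuous.add (continuous_const.mul hh.continuous)) fun g hg => ?_
    have hDg := D.hasSmoothTranspose.1 g hg
    have hDEg := D.hasSmoothTranspose.1 _ hg.eulerOp
    have hhom_int : ∫ ξ, (eulerOp (D.app g) ξ - D.app (eulerOp g) ξ)
        = ∫ ξ, -(r : ℝ) * D.app g ξ := integral_congr_ae (.of_forall (hhom g hg.1))
    rw [integral_sub hDg.eulerOp.integrable hDEg.integrable, integral_const_mul,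
      hint g hg, hint _ hg.eulerOp, integral_mul_eulerOp hh hg] at hhom_int
    have hEone := integral_mul_eulerOp (g := fun _ => 1) contDiff_const hDg
    have hone : ∀ ξ : Fin n → ℝ, eulerOp (fun _ => 1) ξ = 0 := by simp [eulerOp, pd]
    simp only [one_mul, mul_one, hone, add_zero, integral_const_mul, hint g hg] at hEone
    have hhg := (hg.mul_left hh).integrable
    have hEhg := (hg.mul_left hh.eulerOp).integrable
    simp only [add_mul, mul_assoc] at hhom_int ⊢
    rw [integral_add (hhg.const_mul _) hEhg, integral_const_mul] at hhom_int
    rw [integral_add hEhg (hhg.const_mul _), integral_const_mul]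
    linear_combination hhom_int - hEone
  rw [hint f hf]
  simp [eq_zero_of_eulerOp_eq hh hr hEh]
end
end

section
/- In the setting of the deformed Koszul complex, with the conventions 𝐡_{−1} := prol, 𝛛_0 := 𝛊, 𝛛_{k+1} := 0 and 𝐡_k := 0, the deformed operators satisfy the homotopy identities 𝐡_{l−1}∘𝛛_l + 𝛛_{l+1}∘𝐡_l = id on M_l[[λ]] for all 0 ≤ l ≤ k, as well as 𝛊∘𝛛_1 = 0 and 𝛊∘prol = id on N[[λ]]. -/
noncomputable section

/-- Multiplication by `λ` on a formal power series `Σ λ^t F_t`, given by its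
coefficients. -/
def shiftS {M : Type*} [Zero M] (F : ℕ → M) : ℕ → M
  | 0 => 0
  | (t + 1) => F t

/-- A map between formal power series modules `M[[λ]] → M'[[λ]]` is
`R[[λ]]`-linear: additive, `R`-homogeneous, and commuting with multiplication
by `λ`. -/
def LamLinear (R : Type*) [CommRing R] {M M' : Type*} [AddCommGroup M] [Module R M]
    [AddCommGroup M'] [Module R M'] (S : (ℕ → M) → (ℕ → M')) : Prop :=
  (∀ F G, S (F + G) = S F + S G) ∧ (∀ (r : R) (F), S (r • F) = r • S F) ∧
  (∀ F, S (shiftS F) = shiftS (S F))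

/-- The geometric series `(id − S)⁻¹ = Σ_n S^n`, which is well defined (each
coefficient is a finite sum) whenever `S` vanishes to order `≥ 1`. -/
def geomInv {M : Type*} [AddCommMonoid M] (S : (ℕ → M) → (ℕ → M)) (F : ℕ → M) :
    ℕ → M :=
  fun t => ∑ i ∈ Finset.range (t + 1), (S^[i] F) t

/-- The inverse `Op⁻¹ = (id − (id − Op))⁻¹ = Σ_n (id − Op)^n` of an operator of
the form `Op = id − S` with `S` vanishing to order `≥ 1`. -/
def invOp {M : Type*} [AddCommGroup M] (Op : (ℕ → M) → (ℕ → M)) :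
    (ℕ → M) → (ℕ → M) :=
  geomInv (fun G => G - Op G)

/-- The deformed restriction map `𝛊 := ι ∘ (id − (∂_1 − 𝛛_1) ∘ h_0)⁻¹`, where
`d0 = ∂_1`, `h0 = h_0` and `D0 = 𝛛_1`. -/
def iotaB {M0 M1 N : Type*} [AddCommGroup M0] [AddCommGroup M1] [AddCommGroup N]
    (ι : M0 → N) (d0 : M1 → M0) (h0 : M0 → M1) (D0 : (ℕ → M1) → (ℕ → M0)) :
    (ℕ → M0) → (ℕ → N) :=
  fun F => fun t =>
    ι (geomInv (fun G => (fun s => d0 (h0 (G s))) - D0 (fun s => h0 (G s))) F t)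

/-- The deformed homotopies: `𝐡_0 := h_0 ∘ (prol ∘ 𝛊 + 𝛛_1 ∘ h_0)⁻¹` and
`𝐡_l := h_l ∘ (h_{l−1} ∘ 𝛛_l + 𝛛_{l+1} ∘ h_l)⁻¹` for `l ≥ 1`. Here `D l` is
the deformed Koszul boundary `𝛛_{l+1} : M_{l+1}[[λ]] → M_l[[λ]]`, `h l` the
classical homotopy `h_l : M_l → M_{l+1}`, and `d l` the classical boundary
`∂_{l+1} : M_{l+1} → M_l`. -/
def hBold {M : ℕ → Type*} [∀ l, AddCommGroup (M l)] {N : Type*} [AddCommGroup N]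
    (ι : M 0 → N) (prol : N → M 0)
    (h : (l : ℕ) → M l → M (l + 1))
    (d : (l : ℕ) → M (l + 1) → M l)
    (D : (l : ℕ) → (ℕ → M (l + 1)) → (ℕ → M l)) :
    (l : ℕ) → (ℕ → M l) → (ℕ → M (l + 1))
  | 0 => fun F => fun t =>
      h 0 ((invOp (fun G =>
        (fun s => prol (iotaB ι (d 0) (h 0) (D 0) G s))
          + D 0 (fun s => h 0 (G s))) F) t)
  | (j + 1) => fun F => fun t =>
      h (j + 1) ((invOp (fun G =>
        (fun s => h j (D j G s)) + D (j + 1) (fun s => h (j + 1) (G s))) F) t)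

namespace LamLinear

variable {R : Type*} [CommRing R] {M M' M'' : Type*} [AddCommGroup M] [Module R M]
  [AddCommGroup M'] [Module R M'] [AddCommGroup M''] [Module R M'']

theorem map_zero {S : (ℕ → M) → (ℕ → M')} (hS : LamLinear R S) : S 0 = 0 := by
  have h := hS.1 0 0
  rwa [add_zero, left_eq_add] at h

theorem map_sub {S : (ℕ → M) → (ℕ → M')} (hS : LamLinear R S) (F G : ℕ → M) :
    S (F - G) = S F - S G := by
  rw [eq_sub_iff_add_eq, ← hS.1, sub_add_cancel]

theorem map_sum {S : (ℕ → M) → (ℕ → M')} (hS : LamLinear R S) {α : Type*} (s : Finset α)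
    (F : α → ℕ → M) : S (∑ i ∈ s, F i) = ∑ i ∈ s, S (F i) :=
  _root_.map_sum (AddMonoidHom.mk' S hS.1) F s

theorem id : LamLinear R (fun F : ℕ → M => F) :=
  ⟨fun _ _ => rfl, fun _ _ => rfl, fun _ => rfl⟩

theorem zero : LamLinear R (fun _ : ℕ → M => (0 : ℕ → M')) := by
  refine ⟨fun _ _ => (add_zero 0).symm, fun _ _ => (smul_zero _).symm, fun _ => ?_⟩
  funext t
  cases t <;> rfl

/-- The coefficientwise extension of an `R`-linear map is `R[[λ]]`-linear. -/
theorem coeffwise (f : M →ₗ[R] M') : LamLinear R (fun (F : ℕ → M) t => f (F t)) := by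
  refine ⟨fun F G => funext fun t => f.map_add _ _, fun r F => funext fun t => f.map_smul _ _,
    fun F => funext fun t => ?_⟩
  cases t with
  | zero => exact f.map_zero
  | succ t => rfl

theorem comp {S : (ℕ → M') → (ℕ → M'')} {T : (ℕ → M) → (ℕ → M')} (hS : LamLinear R S)
    (hT : LamLinear R T) : LamLinear R (fun F => S (T F)) :=
  ⟨fun F G => by simp only [hT.1, hS.1], fun r F => by simp only [hT.2.1, hS.2.1],
    fun F => by simp only [hT.2.2, hS.2.2]⟩

theorem add {S T : (ℕ → M) → (ℕ → M')} (hS : LamLinear R S) (hT : LamLinear R T) :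
    LamLinear R (fun F => S F + T F) := by
  refine ⟨fun F G => ?_, fun r F => ?_, fun F => ?_⟩
  · simp only [hS.1, hT.1]
    abel
  · simp only [hS.2.1, hT.2.1, smul_add]
  · simp only [hS.2.2, hT.2.2]
    funext t
    cases t <;> simp [shiftS]

theorem sub {S T : (ℕ → M) → (ℕ → M')} (hS : LamLinear R S) (hT : LamLinear R T) :
    LamLinear R (fun F => S F - T F) := by
  refine ⟨fun F G => ?_, fun r F => ?_, fun F => ?_⟩
  · simp only [hS.1, hT.1]
    abel
  · simp only [hS.2.1, hT.2.1, smul_sub]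
  · simp only [hS.2.2, hT.2.2]
    funext t
    cases t <;> simp [shiftS]

/-- An `R[[λ]]`-linear map vanishing to order `≥ 1` raises the order of a power series. -/
theorem apply_eq_zero_of_lt {S : (ℕ → M) → (ℕ → M')} (hS : LamLinear R S)
    (hS0 : ∀ F, S F 0 = 0) (n : ℕ) (F : ℕ → M) (hF : ∀ s < n, F s = 0) :
    ∀ s < n + 1, S F s = 0 := by
  induction n generalizing F with
  | zero =>
    intro s hs
    obtain rfl : s = 0 := by omega
    exact hS0 F
  | succ n ih =>
    have hshift : F = shiftS (fun t => F (t + 1)) := by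
      funext t
      cases t with
      | zero => exact hF 0 n.succ_pos
      | succ t => rfl
    intro s hs
    rw [hshift, hS.2.2]
    cases s with
    | zero => rfl
    | succ s => exact ih _ (fun u hu => hF _ (by omega)) s (by omega)

variable {S : (ℕ → M) → (ℕ → M)}

theorem iterate_apply_eq_zero (hS : LamLinear R S) (hS0 : ∀ F, S F 0 = 0) (n : ℕ)
    (F : ℕ → M) : ∀ s < n, S^[n] F s = 0 := by
  induction n with
  | zero => intro s hs; omega
  | succ n ih =>
    rw [Function.iterate_succ_apply']
    exact hS.apply_eq_zero_of_lt hS0 n _ ih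

theorem eq_zero_of_eq_apply (hS : LamLinear R S) (hS0 : ∀ F, S F 0 = 0) {F : ℕ → M}
    (hF : F = S F) : F = 0 := by
  have key : ∀ n, ∀ s < n, F s = 0 := by
    intro n
    induction n with
    | zero => intro s hs; omega
    | succ n ih =>
      rw [hF]
      exact hS.apply_eq_zero_of_lt hS0 n F ih
  funext t
  exact key (t + 1) t t.lt_succ_self

theorem geomInv_sub_apply (hS : LamLinear R S) (hS0 : ∀ F, S F 0 = 0) (F : ℕ → M) :
    geomInv S F - S (geomInv S F) = F := by
  funext n
  set P : ℕ → M := ∑ i ∈ Finset.range (n + 1), S^[i] F with hP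
  have hagree : ∀ t < n + 1, (geomInv S F - P) t = 0 := by
    intro t ht
    rw [Pi.sub_apply, sub_eq_zero, hP, Finset.sum_apply]
    refine Finset.sum_subset (Finset.range_mono (by omega)) fun i _ hi => ?_
    exact hS.iterate_apply_eq_zero hS0 i F t (by simpa using hi)
  have h1 := hagree n n.lt_succ_self
  have h2 := hS.apply_eq_zero_of_lt hS0 (n + 1) _ hagree n (by omega)
  rw [hS.map_sub] at h2
  have htel : P - S P = F - S^[n + 1] F := by
    rw [hP, hS.map_sum, ← Finset.sum_sub_distrib]
    simp only [← Function.iterate_succ_apply' S]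
    exact Finset.sum_range_sub' (fun i => S^[i] F) (n + 1)
  have h3 := congrFun htel n
  rw [Pi.sub_apply, Pi.sub_apply, hS.iterate_apply_eq_zero hS0 (n + 1) F n n.lt_succ_self,
    sub_zero] at h3
  rw [Pi.sub_apply, sub_eq_zero] at h1 h2
  rw [Pi.sub_apply, h1, h2, h3]

theorem geomInv_eq (hS : LamLinear R S) (hS0 : ∀ F, S F 0 = 0) {F X : ℕ → M}
    (hX : X - S X = F) : geomInv S F = X := by
  refine sub_eq_zero.1 (hS.eq_zero_of_eq_apply hS0 ?_)
  rw [hS.map_sub, ← sub_eq_zero, ← sub_eq_zero.2 ((hS.geomInv_sub_apply hS0 F).trans hX.symm)]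
  abel

theorem geomInv (hS : LamLinear R S) (hS0 : ∀ F, S F 0 = 0) : LamLinear R (geomInv S) := by
  have hid := LamLinear.id.sub hS
  refine ⟨fun F G => hS.geomInv_eq hS0 ?_, fun r F => hS.geomInv_eq hS0 ?_,
    fun F => hS.geomInv_eq hS0 ?_⟩
  · exact (hid.1 _ _).trans
      (congrArg₂ (· + ·) (hS.geomInv_sub_apply hS0 F) (hS.geomInv_sub_apply hS0 G))
  · exact (hid.2.1 r _).trans (congrArg (r • ·) (hS.geomInv_sub_apply hS0 F))
  · exact (hid.2.2 _).trans (congrArg shiftS (hS.geomInv_sub_apply hS0 F))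

variable {Op : (ℕ → M) → (ℕ → M)}

theorem apply_invOp (hOp : LamLinear R Op) (hOp0 : ∀ F, Op F 0 = F 0) (F : ℕ → M) :
    Op (invOp Op F) = F := by
  have h := (LamLinear.id.sub hOp).geomInv_sub_apply (by simp [hOp0]) F
  rwa [sub_sub_cancel] at h

theorem invOp_eq (hOp : LamLinear R Op) (hOp0 : ∀ F, Op F 0 = F 0) {F X : ℕ → M}
    (hX : Op X = F) : invOp Op F = X :=
  (LamLinear.id.sub hOp).geomInv_eq (by simp [hOp0]) (by rwa [sub_sub_cancel])

end LamLinear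

section Augmentation

variable {R : Type*} [CommRing R] {M0 M1 N : Type*} [AddCommGroup M0] [Module R M0]
  [AddCommGroup M1] [Module R M1] [AddCommGroup N] [Module R N]
  {ι : M0 →ₗ[R] N} {d0 : M1 →ₗ[R] M0} {h0 : M0 →ₗ[R] M1} {D0 : (ℕ → M1) → (ℕ → M0)}

theorem lamLinear_perturbation (d0 : M1 →ₗ[R] M0) (h0 : M0 →ₗ[R] M1) (hD : LamLinear R D0) :
    LamLinear R (fun G : ℕ → M0 => (fun s => d0 (h0 (G s))) - D0 (fun s => h0 (G s))) :=
  (LamLinear.coeffwise (d0 ∘ₗ h0)).sub (hD.comp (LamLinear.coeffwise h0))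

theorem lamLinear_iotaB (hD : LamLinear R D0) (hD0 : ∀ F, D0 F 0 = d0 (F 0)) :
    LamLinear R (iotaB ι d0 h0 D0) :=
  (LamLinear.coeffwise ι).comp
    ((lamLinear_perturbation d0 h0 hD).geomInv (by simp [hD0]))

theorem iotaB_apply_zero (F : ℕ → M0) : iotaB ι d0 h0 D0 F 0 = ι (F 0) := by
  simp [iotaB, geomInv]

theorem iotaB_eq (hD : LamLinear R D0) (hD0 : ∀ F, D0 F 0 = d0 (F 0)) {F X : ℕ → M0}
    (hX : X - ((fun s => d0 (h0 (X s))) - D0 (fun s => h0 (X s))) = F) :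
    iotaB ι d0 h0 D0 F = fun t => ι (X t) := by
  funext t
  exact congrArg (fun Y : ℕ → M0 => ι (Y t))
    ((lamLinear_perturbation d0 h0 hD).geomInv_eq (by simp [hD0]) hX)

theorem iotaB_prol {prol : N →ₗ[R] M0} (hD : LamLinear R D0)
    (hD0 : ∀ F, D0 F 0 = d0 (F 0)) (hiprol : ∀ x, ι (prol x) = x)
    (hh0prol : ∀ x, h0 (prol x) = 0) (F : ℕ → N) :
    iotaB ι d0 h0 D0 (fun t => prol (F t)) = F := by
  rw [iotaB_eq (X := fun t => prol (F t)) hD hD0]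
  · simp only [hiprol]
  · have hz : D0 (fun _ => 0) = 0 := hD.map_zero
    funext t
    simp [hh0prol, hz]

/-- The deformed restriction annihilates the image of the deformed boundary. -/
theorem iotaB_boundary {M2 : Type*} [AddCommGroup M2] [Module R M2] {prol : N →ₗ[R] M0}
    {d1 : M2 →ₗ[R] M1} {h1 : M1 →ₗ[R] M2} {D1 : (ℕ → M2) → (ℕ → M1)}
    (hD : LamLinear R D0) (hD0 : ∀ F, D0 F 0 = d0 (F 0))
    (hD' : LamLinear R D1) (hD0' : ∀ F, D1 F 0 = d1 (F 0))
    (hDD : ∀ F, D0 (D1 F) = 0) (hid : ∀ m, ι (d0 m) = 0)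
    (hhomo0 : ∀ m, prol (ι m) + d0 (h0 m) = m)
    (hhomo1 : ∀ m, h0 (d0 m) + d1 (h1 m) = m) (F : ℕ → M1) :
    iotaB ι d0 h0 D0 (D0 F) = 0 := by
  set C : (ℕ → M1) → (ℕ → M1) :=
    fun G => (fun s => h0 (d0 (G s))) + D1 (fun s => h1 (G s)) with hC
  have hClin : LamLinear R C :=
    (LamLinear.coeffwise (h0 ∘ₗ d0)).add (hD'.comp (LamLinear.coeffwise h1))
  have hCF := hClin.apply_invOp (by simp [hC, hD0', hhomo1]) F
  set Y := invOp C F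
  have hDF : D0 F = D0 (fun s => h0 (d0 (Y s))) := by
    rw [← hCF, hC, hD.1, hDD, add_zero]
  rw [iotaB_eq (X := fun t => d0 (Y t)) hD hD0]
  · funext t
    exact hid _
  · have hdhd : ∀ m, d0 (h0 (d0 m)) = d0 m := fun m => by
      simpa [hid] using hhomo0 (d0 m)
    simp only [hdhd]
    rw [sub_sub_cancel, hDF]

end Augmentation

/-- In the setting of the deformed Koszul complex, with the conventions
`𝐡_{−1} := prol`, `𝛛_0 := 𝛊`, `𝛛_{k+1} := 0` and `𝐡_k := 0`, the deformed
operators satisfy the homotopy identities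
`𝐡_{l−1} ∘ 𝛛_l + 𝛛_{l+1} ∘ 𝐡_l = id` on `M_l[[λ]]` for all `0 ≤ l ≤ k`, as
well as `𝛊 ∘ 𝛛_1 = 0` and `𝛊 ∘ prol = id` on `N[[λ]]`. -/
theorem statement14
    {R : Type*} [CommRing R] {k : ℕ} (hk : 1 ≤ k)
    {N : Type*} {M : ℕ → Type*}
    [AddCommGroup N] [Module R N] [∀ l, AddCommGroup (M l)] [∀ l, Module R (M l)]
    -- the classical data: `ι`, `prol`, the boundaries `∂_{l+1} = d l` and the
    -- homotopies `h_l = h l`, with the conventions `∂_{k+1} = 0`, `h_k = 0`: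
    (ι : M 0 →ₗ[R] N) (prol : N →ₗ[R] M 0)
    (d : (l : ℕ) → (M (l + 1) →ₗ[R] M l))
    (h : (l : ℕ) → (M l →ₗ[R] M (l + 1)))
    (hdd : ∀ l, l + 2 ≤ k → ∀ m, d l (d (l + 1) m) = 0)
    (hid : ∀ m, ι (d 0 m) = 0)
    (hiprol : ∀ x, ι (prol x) = x)
    (hh0prol : ∀ x, h 0 (prol x) = 0)
    (hhomo0 : ∀ m : M 0, prol (ι m) + d 0 (h 0 m) = m)
    (hhomo : ∀ j, j + 1 ≤ k → ∀ m : M (j + 1),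
      h j (d j m) + d (j + 1) (h (j + 1) m) = m)
    (hdtop : ∀ m : M (k + 1), d k m = 0)
    (hhtop : ∀ m : M k, h k m = 0)
    -- the deformed Koszul boundaries `𝛛_{l+1} = D l`, with `𝛛_{k+1} = 0`:
    (D : (l : ℕ) → (ℕ → M (l + 1)) → (ℕ → M l))
    (hDlin : ∀ l, l + 1 ≤ k → LamLinear R (D l))
    (hDord : ∀ l, l + 1 ≤ k → ∀ F, D l F 0 = d l (F 0))
    (hDD : ∀ l, l + 2 ≤ k → ∀ F, D l (D (l + 1) F) = 0)
    (hDtop : ∀ F, D k F = 0) :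
    -- the homotopy identity at `l = 0`: `prol ∘ 𝛊 + 𝛛_1 ∘ 𝐡_0 = id`:
    (∀ F : ℕ → M 0,
      (fun t => prol (iotaB (⇑ι) (⇑(d 0)) (⇑(h 0)) (D 0) F t))
        + D 0 (hBold (⇑ι) (⇑prol) (fun l => ⇑(h l)) (fun l => ⇑(d l)) D 0 F) = F)
    ∧
    -- the homotopy identities at `1 ≤ l = j + 1 ≤ k`
    -- (at `l = k` the term `𝛛_{k+1} ∘ 𝐡_k` vanishes by the conventions):
    (∀ j, j + 1 ≤ k → ∀ F : ℕ → M (j + 1),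
      hBold (⇑ι) (⇑prol) (fun l => ⇑(h l)) (fun l => ⇑(d l)) D j (D j F)
        + D (j + 1)
            (hBold (⇑ι) (⇑prol) (fun l => ⇑(h l)) (fun l => ⇑(d l)) D (j + 1) F)
        = F)
    ∧
    -- `𝛊 ∘ 𝛛_1 = 0`:
    (∀ F : ℕ → M 1, iotaB (⇑ι) (⇑(d 0)) (⇑(h 0)) (D 0) (D 0 F) = 0)
    ∧
    -- `𝛊 ∘ prol = id` on `N[[λ]]`:
    (∀ F : ℕ → N,
      iotaB (⇑ι) (⇑(d 0)) (⇑(h 0)) (D 0) (fun t => prol (F t)) = F) := by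
  have hlin : ∀ l, l ≤ k → LamLinear R (D l) := by
    intro l hl
    rcases hl.lt_or_eq with hl | rfl
    · exact hDlin l hl
    · rw [show D l = fun _ => 0 from funext hDtop]
      exact LamLinear.zero
  have hord : ∀ l, l ≤ k → ∀ F, D l F 0 = d l (F 0) := by
    intro l hl F
    rcases hl.lt_or_eq with hl | rfl
    · exact hDord l hl F
    · rw [hDtop, hdtop]
      rfl
  have hsq : ∀ l, l + 1 ≤ k → ∀ F, D l (D (l + 1) F) = 0 := by
    intro l hl F
    rcases hl.lt_or_eq with hl' | rfl
    · exact hDD l hl' F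
    · rw [hDtop, (hlin l (by omega)).map_zero]
  have hiD : ∀ F, iotaB ι (d 0) (h 0) (D 0) (D 0 F) = 0 :=
    iotaB_boundary (hlin 0 k.zero_le) (hord 0 k.zero_le) (hlin 1 hk) (hord 1 hk) (hsq 0 hk) hid
      hhomo0 (hhomo 0 hk)
  have hip : ∀ F : ℕ → N, iotaB ι (d 0) (h 0) (D 0) (fun t => prol (F t)) = F :=
    iotaB_prol (hlin 0 k.zero_le) (hord 0 k.zero_le) hiprol hh0prol
  set A0 : (ℕ → M 0) → (ℕ → M 0) := fun G =>
    (fun s => prol (iotaB ι (d 0) (h 0) (D 0) G s)) + D 0 (fun s => h 0 (G s)) with hA0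
  have hilin : LamLinear R (iotaB ι (d 0) (h 0) (D 0)) :=
    lamLinear_iotaB (hlin 0 k.zero_le) (hord 0 k.zero_le)
  have hA0lin : LamLinear R A0 :=
    ((LamLinear.coeffwise prol).comp hilin).add
      ((hlin 0 k.zero_le).comp (LamLinear.coeffwise (h 0)))
  have hA0ord : ∀ F, A0 F 0 = F 0 := by
    intro F
    simp [hA0, iotaB_apply_zero, hord 0 k.zero_le, hhomo0]
  let A : (j : ℕ) → (ℕ → M (j + 1)) → (ℕ → M (j + 1)) := fun j G =>
    (fun s => h j (D j G s)) + D (j + 1) (fun s => h (j + 1) (G s))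
  have hAlin : ∀ j, j + 1 ≤ k → LamLinear R (A j) := fun j hj =>
    ((LamLinear.coeffwise (h j)).comp (hlin j (by omega))).add
      ((hlin (j + 1) hj).comp (LamLinear.coeffwise (h (j + 1))))
  have hAord : ∀ j, j + 1 ≤ k → ∀ F, A j F 0 = F 0 := by
    intro j hj F
    simp [A, hord j (by omega), hord (j + 1) hj, hhomo j hj]
  refine ⟨fun F => ?_, fun j hj F => ?_, hiD, hip⟩
  · have hX := hA0lin.apply_invOp hA0ord F
    have hiX : iotaB ι (d 0) (h 0) (D 0) F = iotaB ι (d 0) (h 0) (D 0) (invOp A0 F) := by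
      conv_lhs => rw [← hX, hA0]
      rw [hilin.1, hip, hiD, add_zero]
    rw [hiX]
    exact hX
  · have hX := (hAlin j hj).apply_invOp (hAord j hj) F
    set X := invOp (A j) F with hXdef
    have hDX : D j (fun s => h j (D j X s)) = D j F := by
      conv_rhs => rw [← hX]
      rw [(hlin j (by omega)).1, hsq j hj, add_zero]
    have hprev : hBold ι prol (fun l => h l) (fun l => d l) D j (D j F) =
        fun s => h j (D j X s) := by
      cases j with
      | zero =>
        have hinv : invOp A0 (D 0 F) = D 0 X := by
          refine hA0lin.invOp_eq hA0ord ?_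
          rw [← hDX]
          simp only [hA0]
          rw [hiD]
          funext t
          simp
        exact funext fun t => congrArg (fun Y : ℕ → M 0 => h 0 (Y t)) hinv
      | succ i =>
        have hinv : invOp (A i) (D (i + 1) F) = D (i + 1) X := by
          refine (hAlin i (by omega)).invOp_eq (hAord i (by omega)) ?_
          rw [← hDX]
          simp only [A]
          rw [hsq i (by omega)]
          funext t
          simp
        exact funext fun t => congrArg (fun Y : ℕ → M (i + 1) => h (i + 1) (Y t)) hinv
    rw [hprev]
    exact hX
end
end

section
/- In the setting of the deformed Koszul complex, the deformed restriction map 𝛊: M_0[[λ]] → N[[λ]] is surjective and its kernel equals the image of the deformed Koszul boundary: ker 𝛊 = im 𝛛_1 as R[[λ]]-submodules of M_0[[λ]]. -/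
noncomputable section

/-- An additive operator on power series whose `t`-th coefficient vanishes on series of
order `≥ t`: it raises the order by at least one. -/
def RaisesOrder {M : Type*} [AddCommGroup M] (S : (ℕ → M) →+ (ℕ → M)) : Prop :=
  ∀ F t, (∀ s < t, F s = 0) → S F t = 0

theorem RaisesOrder.apply_eq_zero_of_le {M : Type*} [AddCommGroup M]
    {S : (ℕ → M) →+ (ℕ → M)} (hS : RaisesOrder S) {F : ℕ → M} {t : ℕ}
    (hF : ∀ s < t, F s = 0) {s : ℕ} (hs : s ≤ t) : S F s = 0 :=
  hS F s fun r hr => hF r (hr.trans_le hs)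

theorem RaisesOrder.apply_congr {M : Type*} [AddCommGroup M]
    {S : (ℕ → M) →+ (ℕ → M)} (hS : RaisesOrder S) {F G : ℕ → M} {t : ℕ}
    (hFG : ∀ s < t, F s = G s) : S F t = S G t := by
  have := hS (F - G) t fun s hs => by simp [hFG s hs]
  rwa [map_sub, Pi.sub_apply, sub_eq_zero] at this

theorem RaisesOrder.iterate_apply_eq_zero {M : Type*} [AddCommGroup M]
    {S : (ℕ → M) →+ (ℕ → M)} (hS : RaisesOrder S) (F : ℕ → M) (n : ℕ) :
    ∀ s < n, (S^[n] F) s = 0 := by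
  induction n with
  | zero => simp
  | succ n ih =>
    intro s hs
    rw [Function.iterate_succ_apply']
    exact hS.apply_eq_zero_of_le ih (Nat.lt_succ_iff.mp hs)

theorem RaisesOrder.geomInv_sub {M : Type*} [AddCommGroup M]
    {S : (ℕ → M) →+ (ℕ → M)} (hS : RaisesOrder S) (G : ℕ → M) :
    geomInv S (G - S G) = G := by
  funext t
  have hi (i : ℕ) : (S^[i] (G - S G)) t = (S^[i] G) t - (S^[i + 1] G) t := by
    rw [iterate_map_sub, Function.iterate_succ_apply, Pi.sub_apply]
  simp only [geomInv, hi]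
  rw [Finset.sum_range_sub' (fun i => (S^[i] G) t),
    hS.iterate_apply_eq_zero G (t + 1) t t.lt_succ_self]
  simp

theorem RaisesOrder.geomInv_sub_apply_geomInv {M : Type*} [AddCommGroup M]
    {S : (ℕ → M) →+ (ℕ → M)} (hS : RaisesOrder S) (F : ℕ → M) :
    geomInv S F - S (geomInv S F) = F := by
  funext t
  have htrunc : S (geomInv S F) t = S (∑ i ∈ Finset.range t, S^[i] F) t := by
    refine hS.apply_congr fun s hs => ?_
    rw [Finset.sum_apply]
    refine Finset.sum_subset (Finset.range_mono hs) fun i _ hi => ?_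
    exact hS.iterate_apply_eq_zero F i s (by simpa using hi)
  rw [Pi.sub_apply, htrunc, map_sum, Finset.sum_apply, geomInv, Finset.sum_range_succ']
  simp [Function.iterate_succ_apply']

theorem LamLinear.apply_eq_of_order {R M M' : Type*} [CommRing R] [AddCommGroup M]
    [Module R M] [AddCommGroup M'] [Module R M'] {D : (ℕ → M) → (ℕ → M')}
    (hD : LamLinear R D) {d : M → M'} (hd : ∀ F, D F 0 = d (F 0)) (t : ℕ) :
    ∀ F : ℕ → M, (∀ s < t, F s = 0) → D F t = d (F t) := by
  induction t with
  | zero => exact fun F _ => hd F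
  | succ t ih =>
    intro F hF
    have hshift : F = shiftS fun n => F (n + 1) := by
      funext n
      cases n with
      | zero => exact hF 0 t.succ_pos
      | succ n => rfl
    rw [hshift, hD.2.2]
    exact ih _ fun s hs => hF (s + 1) (Nat.succ_lt_succ hs)

/-- In the setting of the deformed Koszul complex, the deformed restriction map
`𝛊 : M_0[[λ]] → N[[λ]]` is surjective and its kernel equals the image of the
deformed Koszul boundary: `ker 𝛊 = im 𝛛_1`. -/
theorem statement15
    {R : Type*} [CommRing R] {k : ℕ} (hk : 1 ≤ k)
    {N : Type*} {M : ℕ → Type*}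
    [AddCommGroup N] [Module R N] [∀ l, AddCommGroup (M l)] [∀ l, Module R (M l)]
    -- the classical data: `ι`, `prol`, the boundaries `∂_{l+1} = d l` and the
    -- homotopies `h_l = h l`, with the conventions `∂_{k+1} = 0`, `h_k = 0`:
    (ι : M 0 →ₗ[R] N) (prol : N →ₗ[R] M 0)
    (d : (l : ℕ) → (M (l + 1) →ₗ[R] M l))
    (h : (l : ℕ) → (M l →ₗ[R] M (l + 1)))
    (hdd : ∀ l, l + 2 ≤ k → ∀ m, d l (d (l + 1) m) = 0)
    (hid : ∀ m, ι (d 0 m) = 0)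
    (hiprol : ∀ x, ι (prol x) = x)
    (hh0prol : ∀ x, h 0 (prol x) = 0)
    (hhomo0 : ∀ m : M 0, prol (ι m) + d 0 (h 0 m) = m)
    (hhomo : ∀ j, j + 1 ≤ k → ∀ m : M (j + 1),
      h j (d j m) + d (j + 1) (h (j + 1) m) = m)
    (hdtop : ∀ m : M (k + 1), d k m = 0)
    (hhtop : ∀ m : M k, h k m = 0)
    -- the deformed Koszul boundaries `𝛛_{l+1} = D l`, with `𝛛_{k+1} = 0`:
    (D : (l : ℕ) → (ℕ → M (l + 1)) → (ℕ → M l))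
    (hDlin : ∀ l, l + 1 ≤ k → LamLinear R (D l))
    (hDord : ∀ l, l + 1 ≤ k → ∀ F, D l F 0 = d l (F 0))
    (hDD : ∀ l, l + 2 ≤ k → ∀ F, D l (D (l + 1) F) = 0)
    (hDtop : ∀ F, D k F = 0) :
    Function.Surjective (iotaB (⇑ι) (⇑(d 0)) (⇑(h 0)) (D 0))
    ∧
    {F : ℕ → M 0 | iotaB (⇑ι) (⇑(d 0)) (⇑(h 0)) (D 0) F = 0}
      = Set.range (D 0) := by
  have hD0 := (hDlin 0 hk).apply_eq_of_order (hDord 0 hk)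
  have hD1 : ∀ (t : ℕ) (F : ℕ → M 2), (∀ s < t, F s = 0) → D 1 F t = d 1 (F t) := by
    obtain rfl | hk' := hk.eq_or_lt
    · intro t F _
      rw [hDtop, hdtop, Pi.zero_apply]
    · exact (hDlin 1 hk').apply_eq_of_order (hDord 1 hk')
  have hD0add := (hDlin 0 hk).1
  have hD1add : ∀ F G, D 1 (F + G) = D 1 F + D 1 G := by
    obtain rfl | hk' := hk.eq_or_lt
    · simp [hDtop]
    · exact (hDlin 1 hk').1
  have hDD0 : ∀ F, D 0 (D 1 F) = 0 := by
    obtain rfl | hk' := hk.eq_or_lt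
    · intro F
      rw [hDtop]
      simpa using hD0add 0 0
    · exact hDD 0 hk'
  let H0 : (ℕ → M 0) →+ (ℕ → M 1) := (h 0).toAddMonoidHom.compLeft ℕ
  let H1 : (ℕ → M 1) →+ (ℕ → M 2) := (h 1).toAddMonoidHom.compLeft ℕ
  let P : (ℕ → M 0) →+ (ℕ → M 0) := (prol ∘ₗ ι).toAddMonoidHom.compLeft ℕ
  let E0 : (ℕ → M 1) →+ (ℕ → M 0) := AddMonoidHom.mk' (D 0) hD0add
  let E1 : (ℕ → M 2) →+ (ℕ → M 1) := AddMonoidHom.mk' (D 1) hD1add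
  let S : (ℕ → M 0) →+ (ℕ → M 0) := ((d 0).toAddMonoidHom.compLeft ℕ).comp H0 - E0.comp H0
  let T : (ℕ → M 1) →+ (ℕ → M 1) := AddMonoidHom.id _ - (H0.comp E0 + E1.comp H1)
  have hS : RaisesOrder S := fun F t hF => by
    change d 0 (h 0 (F t)) - D 0 (fun s => h 0 (F s)) t = 0
    rw [hD0 t _ fun s hs => by rw [hF s hs, map_zero], sub_self]
  have hT : RaisesOrder T := fun F t hF => by
    change F t - (h 0 (D 0 F t) + D 1 (fun s => h 1 (F s)) t) = 0
    rw [hD0 t _ hF, hD1 t _ fun s hs => by rw [hF s hs, map_zero], hhomo 0 hk, sub_self]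
  have hiota (F : ℕ → M 0) (t : ℕ) :
      iotaB ι (d 0) (h 0) (D 0) F t = ι (geomInv S F t) := rfl
  have hSsub (G : ℕ → M 0) : G - S G = P G + D 0 (H0 G) := by
    funext t
    change G t - (d 0 (h 0 (G t)) - D 0 (H0 G) t) = prol (ι (G t)) + D 0 (H0 G) t
    nth_rewrite 1 [← hhomo0 (G t)]
    abel
  have hzero : D 0 0 = 0 := map_zero E0
  constructor
  · intro f
    refine ⟨fun t => prol (f t), ?_⟩
    have hfix : (fun t => prol (f t)) - S (fun t => prol (f t)) = fun t => prol (f t) := by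
      have hH : H0 (fun t => prol (f t)) = 0 := funext fun t => hh0prol (f t)
      have hP : P (fun t => prol (f t)) = fun t => prol (f t) :=
        funext fun t => congrArg prol (hiprol (f t))
      rw [hSsub, hH, hP, hzero, add_zero]
    funext t
    rw [hiota, ← hfix, hS.geomInv_sub, hiprol]
  · ext F
    constructor
    · intro hF
      have hP : P (geomInv S F) = 0 := by
        funext t
        change prol (ι (geomInv S F t)) = 0
        rw [← hiota, show iotaB ι (d 0) (h 0) (D 0) F = 0 from hF, Pi.zero_apply, map_zero]
      refine ⟨H0 (geomInv S F), ?_⟩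
      rw [← zero_add (D 0 _), ← hP, ← hSsub, hS.geomInv_sub_apply_geomInv]
    · rintro ⟨F, rfl⟩
      have hF : F = H0 (D 0 (geomInv T F)) + D 1 (H1 (geomInv T F)) := by
        conv_lhs => rw [← hT.geomInv_sub_apply_geomInv F]
        exact sub_sub_cancel _ _
      set K := D 0 (geomInv T F)
      have hHP : H0 (P K) = 0 := funext fun t => hh0prol (ι (K t))
      have hPP : P (P K) = P K := funext fun t => congrArg prol (hiprol (ι (K t)))
      have hDF : D 0 F = (K - P K) - S (K - P K) := by
        rw [hSsub, map_sub, map_sub, hPP, hHP, sub_self, sub_zero, zero_add, hF, hD0add,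
          hDD0, add_zero]
      funext t
      rw [hiota, hDF, hS.geomInv_sub, Pi.sub_apply, map_sub]
      change ι (K t) - ι (prol (ι (K t))) = 0
      rw [hiprol, sub_self]
end
end
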